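/- Let Σ be an e-invariant type and suppose e ∈ dcl(Σ). Then Gal^0_L(Σ, e) = Autf_S(Σ, e)/Autf_L(Σ, e), i.e., the connected component of the identity of the relativized Lascar group Gal_L(Σ, e) equals the image of the relativized Shelah automorphism group. -/

import Mathlib

/- Framework: relativized Lascar groups of a first-order theory over a
hyperimaginary, following "Relativized Galois groups of first order theories
over a hyperimaginary" by H. Lee and J. Lee. -/

open FirstOrder Cardinal Pointwise

universe u

namespace RelLascar

variable {L : FirstOrder.Language.{u, u}} {M : Type u} [L.Structure M]

/-- The group of automorphisms of the monster model `M`. -/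
instance : Group (M ≃[L] M) where
  mul f g := f.comp g
  one := FirstOrder.Language.Equiv.refl L M
  inv f := f.symm
  mul_assoc f g h := (FirstOrder.Language.Equiv.comp_assoc h g f).symm
  one_mul := FirstOrder.Language.Equiv.refl_comp
  mul_one := FirstOrder.Language.Equiv.comp_refl
  inv_mul_cancel := FirstOrder.Language.Equiv.symm_comp_self

/-- Automorphisms act on the monster model. -/
instance : MulAction (M ≃[L] M) M where
  smul f x := f x
  one_smul _ := rfl
  mul_smul _ _ _ := rfl

@[simp] theorem autSmul_def (f : M ≃[L] M) (x : M) : f • x = f x := rfl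

/-- The solution set in `M` of a set of formulas in variables `ι` with
parameters `prm : π → M`. -/
def SolSet {ι π : Type u} (p : Set (L.Formula (ι ⊕ π))) (prm : π → M) : Set (ι → M) :=
  {v | ∀ φ ∈ p, φ.Realize (Sum.elim v prm)}

/-- A set of `ι`-tuples is type-definable over the parameters `prm`. -/
def TypeDefinableOver {ι π : Type u} (prm : π → M) (X : Set (ι → M)) : Prop :=
  ∃ p : Set (L.Formula (ι ⊕ π)), X = SolSet p prm

/-- Two tuples have the same (complete) type over `∅`. -/
def SameTp {ι : Type u} (c d : ι → M) : Prop :=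
  ∀ φ : L.Formula ι, φ.Realize c ↔ φ.Realize d

/-- `M` is a monster model with degree of saturation and strong homogeneity `κ`:
`κ` is uncountable, tuples of size `< κ` with the same type are conjugate under an
automorphism, and every partial type in `< κ` variables over `< κ` parameters that
is finitely realized in `M` is realized in `M`.  ("Small" means of size `< κ`.) -/
def IsMonster (κ : Cardinal.{u}) (L : FirstOrder.Language.{u, u}) (M : Type u) [L.Structure M] : Prop :=
  ℵ₀ < κ ∧
  (∀ (ι : Type u) (c d : ι → M), #ι < κ → SameTp (L := L) (M := M) c d →
      ∃ f : M ≃[L] M, ∀ i, f (c i) = d i) ∧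
  (∀ (ι π : Type u) (prm : π → M) (p : Set (L.Formula (ι ⊕ π))), #ι < κ → #π < κ →
      (∀ q : Finset (L.Formula (ι ⊕ π)), ↑q ⊆ p →
        ∃ v : ι → M, ∀ φ ∈ (q : Set (L.Formula (ι ⊕ π))), φ.Realize (Sum.elim v prm)) →
      ∃ v : ι → M, v ∈ SolSet p prm)

variable (κ : Cardinal.{u})

section Hyperimaginary

/- The hyperimaginary `e = a_E`, where `E` is the `∅`-type-definable equivalence
relation defined by the set of formulas `pE` and `a : γ → M`. -/
variable {γ : Type u} (pE : Set (L.Formula (γ ⊕ γ))) (a : γ → M)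

/-- The relation defined by a set of formulas in variables `δ ⊕ δ` (with no
parameters); for `pE` this is the equivalence relation `E`. -/
def Frel {δ : Type u} (pF : Set (L.Formula (δ ⊕ δ))) (x y : δ → M) : Prop :=
  ∀ φ ∈ pF, φ.Realize (Sum.elim x y)

/-- The class of a tuple `x` under the relation defined by `pF`; for an
equivalence relation this is the hyperimaginary `x_F` (as a set of representatives). -/
def Fclass {δ : Type u} (pF : Set (L.Formula (δ ⊕ δ))) (x : δ → M) : Set (δ → M) :=
  {y | Frel pF x y}

/-- `Aut_e(𝔠)`: the subgroup of automorphisms fixing the hyperimaginary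
`e = a_E` setwise. -/
def AutE : Subgroup (M ≃[L] M) := MulAction.stabilizer (M ≃[L] M) (Fclass pE a)

/-- `Aut_e(𝔠)` as a group. -/
abbrev Ge := ↥(AutE pE a)

/-- The hyperimaginary `e` is definable over the tuple `t` (i.e. `e ∈ dcl(t)`):
every automorphism fixing `t` pointwise fixes `e`. -/
def eInDclTuple {ι : Type u} (t : ι → M) : Prop :=
  ∀ f : M ≃[L] M, (∀ i, f (t i) = t i) → f ∈ AutE pE a

/-- The set of elements of `Aut_e(𝔠)` fixing pointwise some small elementary
substructure (model) `N` with `e ∈ dcl(N)`. -/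
def modelFixers : Set (Ge pE a) :=
  {f | ∃ N : L.ElementarySubstructure M, #N < κ ∧
        (∀ g : M ≃[L] M, (∀ x ∈ N, g x = x) → g ∈ AutE pE a) ∧
        ∀ x ∈ N, (f : M ≃[L] M) x = x}

/-- `Autf_L(𝔠, e)`: the normal subgroup of `Aut_e(𝔠)` generated by the
pointwise stabilizers of small models `N` with `e ∈ dcl(N)`. -/
def AutfL : Subgroup (Ge pE a) := Subgroup.normalClosure (modelFixers κ pE a)

/-- `c ≡ᴸ_e d` : the tuples have the same Lascar strong type over `e`. -/
def LEq {ι : Type u} (c d : ι → M) : Prop := ∃ f ∈ AutfL κ pE a, f • c = d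

theorem LEq.refl {ι : Type u} (c : ι → M) : LEq κ pE a c c :=
  ⟨1, one_mem _, one_smul _ _⟩

theorem LEq.symm {ι : Type u} {c d : ι → M} (h : LEq κ pE a c d) : LEq κ pE a d c := by
  obtain ⟨f, hf, rfl⟩ := h
  exact ⟨f⁻¹, inv_mem hf, inv_smul_smul f c⟩

theorem LEq.trans {ι : Type u} {c d e : ι → M} (h1 : LEq κ pE a c d)
    (h2 : LEq κ pE a d e) : LEq κ pE a c e := by
  obtain ⟨f, hf, rfl⟩ := h1
  obtain ⟨g, hg, rfl⟩ := h2
  exact ⟨g * f, mul_mem hg hf, (mul_smul g f c).symm ▸ rfl⟩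

end Hyperimaginary

section Sigma

variable {γ : Type u} (pE : Set (L.Formula (γ ⊕ γ))) (a : γ → M)
variable {V β : Type u} {pS : Set (L.Formula (V ⊕ β))} {bp : β → M}

/-- The solution set `Σ(𝔠)` of the partial type `Σ` (given by formulas `pS` over
the parameters `bp`). -/
abbrev Sol (pS : Set (L.Formula (V ⊕ β))) (bp : β → M) : Set (V → M) := SolSet pS bp

/-- The type of realizations of `Σ`. -/
abbrev SolT (pS : Set (L.Formula (V ⊕ β))) (bp : β → M) := ↥(Sol pS bp)

variable (pS bp) in
/-- The partial type `Σ` is `e`-invariant. -/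
def SolInv : Prop := ∀ (g : Ge pE a) (v : V → M), v ∈ Sol pS bp → g • v ∈ Sol pS bp

/-- The restriction homomorphism `Aut_e(𝔠) → Perm(Σ(𝔠))`, `f ↦ f ↾ Σ(𝔠)`. -/
def resPerm (hInv : SolInv pE a pS bp) : Ge pE a →* Equiv.Perm (SolT pS bp) where
  toFun g :=
    { toFun := fun v => ⟨g • (v : V → M), hInv g v v.2⟩
      invFun := fun v => ⟨g⁻¹ • (v : V → M), hInv g⁻¹ v v.2⟩
      left_inv := fun v => Subtype.ext (inv_smul_smul g (v : V → M))
      right_inv := fun v => Subtype.ext (smul_inv_smul g (v : V → M)) }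
  map_one' := Equiv.ext fun v => Subtype.ext (one_smul (Ge pE a) (v : V → M))
  map_mul' g h := Equiv.ext fun v => Subtype.ext (mul_smul g h (v : V → M))

/-- `Aut_e(Σ) = {f ↾ Σ(𝔠) : f ∈ Aut_e(𝔠)}`, as a subgroup of the permutations of
`Σ(𝔠)`. -/
def AutES (hInv : SolInv pE a pS bp) : Subgroup (Equiv.Perm (SolT pS bp)) :=
  (resPerm pE a hInv).range

/-- `Aut_e(Σ)` as a group. -/
abbrev GS (hInv : SolInv pE a pS bp) := ↥(AutES pE a hInv)

/-- The restriction map `ξ : Aut_e(𝔠) → Aut_e(Σ)`. -/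
def toGS (hInv : SolInv pE a pS bp) : Ge pE a →* GS pE a hInv :=
  (resPerm pE a hInv).rangeRestrict

/-- A tuple of realizations of `Σ`, flattened to a tuple of elements of `M`. -/
def flat {ι : Type u} (c : ι → SolT pS bp) : ι × V → M := fun p => (c p.1 : V → M) p.2

theorem flat_toGS_smul (hInv : SolInv pE a pS bp) {ι : Type u} (g : Ge pE a)
    (c : ι → SolT pS bp) : flat ((toGS pE a hInv g) • c) = g • flat c := rfl

theorem flat_smul_of_res (hInv : SolInv pE a pS bp) {ι : Type u} {τ : GS pE a hInv}
    {g : Ge pE a} (hg : resPerm pE a hInv g = ↑τ) (c : ι → SolT pS bp) :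
    flat (τ • c) = g • flat c := by
  have : τ = toGS pE a hInv g := Subtype.ext hg.symm
  subst this
  rfl

/-- `Autf_L(Σ, e)`: the subgroup of `Aut_e(Σ)` consisting of those restricted
automorphisms `σ` such that every small tuple of realizations of `Σ` has the same
Lascar strong type over `e` as its image under `σ`. -/
def AutfLS (hInv : SolInv pE a pS bp) : Subgroup (GS pE a hInv) where
  carrier := {σ | ∀ (ι : Type u), #ι < κ → ∀ c : ι → SolT pS bp,
      LEq κ pE a (flat c) (flat (σ • c))}
  one_mem' := by
    intro ι _ c
    rw [one_smul]
    exact LEq.refl κ pE a _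
  mul_mem' := by
    intro σ τ hσ hτ ι hι c
    rw [mul_smul]
    exact LEq.trans κ pE a (hτ ι hι c) (hσ ι hι (τ • c))
  inv_mem' := by
    intro σ hσ ι hι c
    have h := hσ ι hι (σ⁻¹ • c)
    rw [smul_inv_smul] at h
    exact LEq.symm κ pE a h

theorem AutfLS_normal (hInv : SolInv pE a pS bp) : (AutfLS κ pE a hInv).Normal := by
  constructor
  intro σ hσ τ ι hι c
  obtain ⟨g, hg⟩ := τ.2
  have hginv : resPerm pE a hInv g⁻¹ = ↑τ⁻¹ := by
    rw [map_inv, hg]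
    rfl
  obtain ⟨f, hf, hfe⟩ := hσ ι hι (τ⁻¹ • c)
  refine ⟨g * f * g⁻¹, (Subgroup.normalClosure_normal).conj_mem f hf g, ?_⟩
  have h1 : flat (τ⁻¹ • c) = g⁻¹ • flat c := flat_smul_of_res pE a hInv hginv c
  have h2 : flat ((τ * σ * τ⁻¹) • c) = g • flat (σ • τ⁻¹ • c) := by
    rw [mul_smul, mul_smul]
    exact flat_smul_of_res pE a hInv hg _
  rw [h2, ← hfe, h1, ← mul_smul, ← mul_smul]

/-- The relativized Lascar group `Gal_L(Σ, e) = Aut_e(Σ) / Autf_L(Σ, e)`. -/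
def GalL (hInv : SolInv pE a pS bp) := GS pE a hInv ⧸ AutfLS κ pE a hInv

/-- The projection `π_b : Aut_e(Σ) → Gal_L(Σ, e)`. -/
def projb (hInv : SolInv pE a pS bp) : GS pE a hInv → GalL κ pE a hInv :=
  QuotientGroup.mk

/-- The projection `π_Σ : Aut_e(𝔠) → Gal_L(Σ, e)`. -/
def projS (hInv : SolInv pE a pS bp) : Ge pE a → GalL κ pE a hInv :=
  fun g => projb κ pE a hInv (toGS pE a hInv g)

/-- A Lascar tuple in `Σ` over `e`: a small tuple `b` of realizations of `Σ` such
that `Autf_L(Σ, e) = {σ ∈ Aut_e(Σ) : b ≡ᴸ_e σ(b)}`. -/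
def IsLascarTuple (hInv : SolInv pE a pS bp) {ιb : Type u} (b : ιb → SolT pS bp) : Prop :=
  #ιb < κ ∧ ∀ σ : GS pE a hInv,
    σ ∈ AutfLS κ pE a hInv ↔ LEq κ pE a (flat b) (flat (σ • b))

variable (pS bp) in
/-- `e ∈ dcl(Σ)`: there is a small tuple of realizations of `Σ` over which `e` is
definable. -/
def eInDclSigma : Prop :=
  ∃ (ι : Type u) (c : ι → SolT pS bp), #ι < κ ∧ eInDclTuple pE a (flat c)

/-- The complete type of the tuple `v` over the parameters `prm` (with both
indexed by `ι`): the set of formulas realized by `v` with parameters `prm`. -/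
def tpOver {ι : Type u} (prm v : ι → M) : Set (L.Formula (ι ⊕ ι)) :=
  {φ | φ.Realize (Sum.elim v prm)}

/-- The type space `S_b(b) = {tp(f(b)/b) : f ∈ Aut_e(𝔠)}` over a tuple `b` of
realizations of `Σ`. -/
def Sb {ιb : Type u} (b : ιb → SolT pS bp) :
    Set (Set (L.Formula ((ιb × V) ⊕ (ιb × V)))) :=
  Set.range fun g : Ge pE a => tpOver (flat b) (g • flat b)

/-- The logic topology on a set of types: the subspace topology induced from the
product topology on `Formula → Bool` via characteristic functions. -/
noncomputable def typeSetTop {F : Type u} (X : Set (Set F)) : TopologicalSpace ↥X :=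
  TopologicalSpace.induced
    (fun p (φ : F) => (p : Set F).boolIndicator φ) inferInstance

/-- The map `ν_b : S_b(b) → Gal_L(Σ, e)`, `tp(σ(b)/b) ↦ [σ]`. -/
noncomputable def nub (hInv : SolInv pE a pS bp) {ιb : Type u} (b : ιb → SolT pS bp) :
    ↥(Sb pE a b) → GalL κ pE a hInv :=
  fun p => projS κ pE a hInv (Set.mem_range.mp p.2).choose

/-- The topology `𝔱_b` on the relativized Lascar group `Gal_L(Σ, e)`: the quotient
topology induced by `ν_b` from the logic topology on `S_b(b)`. -/
noncomputable def galTopb (hInv : SolInv pE a pS bp) {ιb : Type u}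
    (b : ιb → SolT pS bp) : TopologicalSpace (GalL κ pE a hInv) :=
  (typeSetTop (Sb pE a b)).coinduced (nub κ pE a hInv b)

end Sigma

section GalT

variable {γ : Type u} (pE : Set (L.Formula (γ ⊕ γ))) (a : γ → M)

/-- The Lascar group `Gal_L(T, e) = Aut_e(𝔠) / Autf_L(𝔠, e)`. -/
def GalT := Ge pE a ⧸ AutfL κ pE a

/-- The projection `π : Aut_e(𝔠) → Gal_L(T, e)`. -/
def projT : Ge pE a → GalT κ pE a := QuotientGroup.mk

/-- The type space `S_N(N) = {tp(f(N)/N) : f ∈ Aut_e(𝔠)}` over a small model `N`. -/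
def SMod (N : L.ElementarySubstructure M) : Set (Set (L.Formula (↥N ⊕ ↥N))) :=
  Set.range fun g : Ge pE a =>
    tpOver (Subtype.val : ↥N → M) (g • (Subtype.val : ↥N → M))

/-- The map `ν : S_N(N) → Gal_L(T, e)`, `tp(f(N)/N) ↦ [f]`. -/
noncomputable def nuT (N : L.ElementarySubstructure M) :
    ↥(SMod pE a N) → GalT κ pE a :=
  fun p => projT κ pE a (Set.mem_range.mp p.2).choose

/-- The standard quotient topology on the Lascar group `Gal_L(T, e)` induced via
the type space over a small model `N` (with `e ∈ dcl(N)`). -/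
noncomputable def galTopT (N : L.ElementarySubstructure M) :
    TopologicalSpace (GalT κ pE a) :=
  (typeSetTop (SMod pE a N)).coinduced (nuT κ pE a N)

/-- `Autf_KP(𝔠, e)`: the preimage under `π` of the closure of the identity in
`Gal_L(T, e)`. -/
noncomputable def AutfKPset (N : L.ElementarySubstructure M) : Set (Ge pE a) :=
  projT κ pE a ⁻¹' (@closure _ (galTopT κ pE a N) {projT κ pE a 1})

/-- `Autf_S(𝔠, e)`: the preimage under `π` of the connected component of the
identity in `Gal_L(T, e)`. -/
noncomputable def AutfSset (N : L.ElementarySubstructure M) : Set (Ge pE a) :=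
  projT κ pE a ⁻¹' (@connectedComponent _ (galTopT κ pE a N) (projT κ pE a 1))

/-- `c ≡ᴷᴾ_e d` : the tuples have the same KP strong type over `e`. -/
def KPeq (N : L.ElementarySubstructure M) {ι : Type u} (c d : ι → M) : Prop :=
  ∃ f ∈ AutfKPset κ pE a N, f • c = d

/-- `c ≡ˢ_e d` : the tuples have the same Shelah strong type over `e`. -/
def Seq (N : L.ElementarySubstructure M) {ι : Type u} (c d : ι → M) : Prop :=
  ∃ f ∈ AutfSset κ pE a N, f • c = d

end GalT

section Relativized

variable {γ : Type u} (pE : Set (L.Formula (γ ⊕ γ))) (a : γ → M)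
variable {V β : Type u} {pS : Set (L.Formula (V ⊕ β))} {bp : β → M}

/-- `Autf_KP(Σ, e)`: the set of restricted automorphisms fixing the KP strong
type of every small tuple of realizations of `Σ`. -/
noncomputable def AutfKPSset (hInv : SolInv pE a pS bp) (N : L.ElementarySubstructure M) :
    Set (GS pE a hInv) :=
  {σ | ∀ (ι : Type u), #ι < κ → ∀ c : ι → SolT pS bp,
      KPeq κ pE a N (flat c) (flat (σ • c))}

/-- `Autf_S(Σ, e)`: the set of restricted automorphisms fixing the Shelah strong
type of every small tuple of realizations of `Σ`. -/
noncomputable def AutfSSset (hInv : SolInv pE a pS bp) (N : L.ElementarySubstructure M) :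
    Set (GS pE a hInv) :=
  {σ | ∀ (ι : Type u), #ι < κ → ∀ c : ι → SolT pS bp,
      Seq κ pE a N (flat c) (flat (σ • c))}

/-- The orbit under `Aut_e(𝔠)` of the hyperimaginary given by the class of `x`
under the relation defined by `pF` is small ("`x_F` is bounded over `e`"). -/
def BoundedClass {δ : Type u} (pF : Set (L.Formula (δ ⊕ δ))) (x : δ → M) : Prop :=
  #↥(Set.range fun g : Ge pE a => g • Fclass pF x) < κ

/-- The orbit under `Aut_e(𝔠)` of the hyperimaginary given by the class of `x` is
finite ("`x_F` is algebraic over `e`"). -/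
def FiniteClass {δ : Type u} (pF : Set (L.Formula (δ ⊕ δ))) (x : δ → M) : Prop :=
  (Set.range fun g : Ge pE a => g • Fclass pF x).Finite

/-- `f` fixes the hyperimaginary given by the class of `x` (setwise). -/
def FixesClass (f : Ge pE a) {δ : Type u} (pF : Set (L.Formula (δ ⊕ δ)))
    (x : δ → M) : Prop :=
  f • Fclass pF x = Fclass pF x

variable (pS bp) in
/-- `f` fixes every hyperimaginary that is bounded over `e` and has a
representative which is a small tuple of realizations of `Σ`, i.e. `f` fixes
`bdd(e) ∩ Σ` pointwise. -/
def fixesAllBddS (f : Ge pE a) : Prop :=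
  ∀ (ι : Type u) (pF : Set (L.Formula ((ι × V) ⊕ (ι × V)))) (c : ι → SolT pS bp),
    #ι < κ → Equivalence (Frel (M := M) pF) → BoundedClass κ pE a pF (flat c) →
    FixesClass pE a f pF (flat c)

variable (pS bp) in
/-- `f` fixes every hyperimaginary that is algebraic over `e` and has a
representative which is a small tuple of realizations of `Σ`, i.e. `f` fixes
`acl(e) ∩ Σ` pointwise. -/
def fixesAllAclS (f : Ge pE a) : Prop :=
  ∀ (ι : Type u) (pF : Set (L.Formula ((ι × V) ⊕ (ι × V)))) (c : ι → SolT pS bp),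
    #ι < κ → Equivalence (Frel (M := M) pF) → FiniteClass pE a pF (flat c) →
    FixesClass pE a f pF (flat c)

end Relativized


section More

variable {γ : Type u} (pE : Set (L.Formula (γ ⊕ γ))) (a : γ → M)
variable {V β : Type u} {pS : Set (L.Formula (V ⊕ β))} {bp : β → M}

theorem mem_AutfLS_iff (hInv : SolInv pE a pS bp) {σ : GS pE a hInv} :
    σ ∈ AutfLS κ pE a hInv ↔ ∀ (ι : Type u), #ι < κ → ∀ c : ι → SolT pS bp,
      LEq κ pE a (flat c) (flat (σ • c)) := Iff.rfl

theorem toGS_mem_autfLS (hInv : SolInv pE a pS bp) {f : Ge pE a}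
    (hf : f ∈ AutfL κ pE a) : toGS pE a hInv f ∈ AutfLS κ pE a hInv :=
  (mem_AutfLS_iff κ pE a hInv).mpr
    (fun ι _ c => ⟨f, hf, (flat_toGS_smul pE a hInv f c).symm⟩)

instance AutfL_normal : (AutfL κ pE a).Normal :=
  Subgroup.normalClosure_normal

/-- The group structure of the relativized Lascar group `Gal_L(Σ, e)`. -/
noncomputable def galLGroup (hInv : SolInv pE a pS bp) : Group (GalL κ pE a hInv) :=
  @QuotientGroup.Quotient.group _ _ (AutfLS κ pE a hInv) (AutfLS_normal κ pE a hInv)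

/-- The natural projection `ξ_L : Gal_L(T, e) → Gal_L(Σ, e)`. -/
noncomputable def xiL (hInv : SolInv pE a pS bp) : GalT κ pE a → GalL κ pE a hInv :=
  haveI := AutfLS_normal κ pE a hInv
  ⇑(QuotientGroup.map (AutfL κ pE a) (AutfLS κ pE a hInv) (toGS pE a hInv)
    (fun _ hf => Subgroup.mem_comap.mpr (toGS_mem_autfLS κ pE a hInv hf)))

/-- The orbit equivalence relation `≡ᴴ` of a set `H` of restricted automorphisms,
on tuples of realizations of `Σ`. -/
def orbEq {hInv : SolInv pE a pS bp} (H : Set (GS pE a hInv)) {ι : Type u}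
    (c d : ι → SolT pS bp) : Prop :=
  ∃ h ∈ H, h • c = d

end More


section Topological

open Topology

/-- A quotient of a compact space by a closed equivalence relation is Hausdorff. -/
theorem t2Space_of_isQuotientMap_of_isClosed {X Y : Type*} [TopologicalSpace X]
    [TopologicalSpace Y] [CompactSpace X] {q : X → Y} (hq : IsQuotientMap q)
    (hR : IsClosed {p : X × X | q p.1 = q p.2}) : T2Space Y := by
  have hcl : IsClosedMap q := by
    intro F hF
    rw [← hq.isClosed_preimage]
    have hF' : IsClosed ({p : X × X | q p.1 = q p.2} ∩ Prod.fst ⁻¹' F) :=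
      hR.inter (hF.preimage continuous_fst)
    convert isClosedMap_snd_of_compactSpace _ hF' using 1
    ext x
    constructor
    · rintro ⟨y, hy, hyx⟩
      exact ⟨(y, x), ⟨hyx, hy⟩, rfl⟩
    · rintro ⟨⟨y, x'⟩, ⟨hyx, hy⟩, rfl⟩
      exact ⟨y, hy, hyx⟩
  have hfib (y : Y) : IsCompact (q ⁻¹' {y}) := by
    obtain ⟨x, rfl⟩ := hq.surjective y
    have hx : IsClosed (q '' {z | q z = q x}) :=
      hcl _ (hR.preimage (Continuous.prodMk continuous_id continuous_const))
    have h1 : q '' {z | q z = q x} = {q x} := by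
      ext y
      constructor
      · rintro ⟨z, hz, rfl⟩
        exact hz
      · rintro rfl
        exact ⟨x, rfl, rfl⟩
    rw [h1] at hx
    exact (hx.preimage hq.continuous).isCompact
  refine ⟨fun y z hyz => ?_⟩
  obtain ⟨u, v, hu, hv, hyu, hzv, huv⟩ :=
    generalized_tube_lemma (hfib y) (hfib z) hR.isOpen_compl (by
      rintro ⟨a, b⟩ ⟨ha, hb⟩ hab
      exact hyz (ha.symm.trans (hab.trans hb)))
  refine ⟨Set.kernImage q u, Set.kernImage q v, isClosedMap_iff_kernImage.1 hcl hu,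
    isClosedMap_iff_kernImage.1 hcl hv, fun x hx => hyu hx, fun x hx => hzv hx, ?_⟩
  rw [Set.disjoint_left]
  intro w hw1 hw2
  obtain ⟨x, rfl⟩ := hq.surjective w
  exact huv (Set.mk_mem_prod (hw1 rfl) (hw2 rfl)) rfl

section Division

variable {Γ : Type*} [Group Γ] [TopologicalSpace Γ] {A : Subgroup Γ} [A.Normal]

theorem continuous_inv_of_continuous_div
    (hdiv : Continuous fun p : Γ × Γ => ((p.1⁻¹ * p.2 : Γ) : Γ ⧸ A)) :
    Continuous fun x : Γ ⧸ A => x⁻¹ := by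
  refine (isQuotientMap_quotient_mk' (s := QuotientGroup.leftRel A)).continuous_iff.2 ?_
  convert hdiv.comp (Continuous.prodMk continuous_id (continuous_const (y := (1 : Γ)))) using 1
  ext f
  change ((f : Γ ⧸ A))⁻¹ = ((f⁻¹ * 1 : Γ) : Γ ⧸ A)
  rw [mul_one, QuotientGroup.mk_inv]

theorem separatelyContinuousMul_of_continuous_div
    (hdiv : Continuous fun p : Γ × Γ => ((p.1⁻¹ * p.2 : Γ) : Γ ⧸ A)) :
    SeparatelyContinuousMul (Γ ⧸ A) := by
  have hinv := continuous_inv_of_continuous_div hdiv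
  have hleft (x : Γ ⧸ A) : Continuous (x * ·) := by
    induction x using QuotientGroup.induction_on with | _ g =>
    refine (isQuotientMap_quotient_mk' (s := QuotientGroup.leftRel A)).continuous_iff.2 ?_
    convert hdiv.comp (Continuous.prodMk (continuous_const (y := g⁻¹)) continuous_id) using 1
    ext f
    change (g : Γ ⧸ A) * (f : Γ ⧸ A) = ((g⁻¹⁻¹ * f : Γ) : Γ ⧸ A)
    rw [inv_inv, QuotientGroup.mk_mul]
  refine ⟨fun {x} => hleft x, fun {x} => ?_⟩
  convert hinv.comp ((hleft x⁻¹).comp hinv) using 1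
  ext y
  simp

/-- The preimage in `Γ` of the connected component of the identity of `Γ ⧸ A`. -/
def componentSubgroup [SeparatelyContinuousMul (Γ ⧸ A)] : Subgroup Γ where
  carrier := {f | (f : Γ ⧸ A) ∈ connectedComponent (1 : Γ ⧸ A)}
  one_mem' := mem_connectedComponent
  mul_mem' {f g} hf hg := by
    have h := smul_connectedComponent (f : Γ ⧸ A) 1
    rw [mul_one, ← connectedComponent_eq hf] at h
    change ((f * g : Γ) : Γ ⧸ A) ∈ connectedComponent (1 : Γ ⧸ A)
    rw [← h, QuotientGroup.mk_mul]
    exact Set.smul_mem_smul_set hg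
  inv_mem' {f} hf := by
    have h := smul_connectedComponent (f : Γ ⧸ A)⁻¹ f
    rw [inv_mul_cancel, ← connectedComponent_eq hf] at h
    change ((f⁻¹ : Γ) : Γ ⧸ A) ∈ connectedComponent (1 : Γ ⧸ A)
    rw [← h, QuotientGroup.mk_inv]
    exact ⟨1, mem_connectedComponent, mul_one _⟩

theorem mem_componentSubgroup [SeparatelyContinuousMul (Γ ⧸ A)] {f : Γ} :
    f ∈ componentSubgroup (A := A) ↔ (f : Γ ⧸ A) ∈ connectedComponent (1 : Γ ⧸ A) := Iff.rfl

instance componentSubgroup_normal [SeparatelyContinuousMul (Γ ⧸ A)] :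
    (componentSubgroup (A := A)).Normal := by
  refine ⟨fun f hf g => ?_⟩
  have hc : Continuous fun x : Γ ⧸ A => (g : Γ ⧸ A) * x * (g : Γ ⧸ A)⁻¹ :=
    (continuous_mul_const _).comp (continuous_const_mul _)
  have h := hc.mapsTo_connectedComponent 1 hf
  simpa [mem_componentSubgroup] using h

theorem le_componentSubgroup [SeparatelyContinuousMul (Γ ⧸ A)] :
    A ≤ componentSubgroup (A := A) := by
  intro f hf
  rw [mem_componentSubgroup, (QuotientGroup.eq_one_iff f).2 hf]
  exact mem_connectedComponent

theorem t2Space_quotient_componentSubgroup [CompactSpace Γ] [SeparatelyContinuousMul (Γ ⧸ A)]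
    (hdiv : Continuous fun p : Γ × Γ => ((p.1⁻¹ * p.2 : Γ) : Γ ⧸ A)) :
    T2Space (Γ ⧸ componentSubgroup (A := A)) := by
  refine t2Space_of_isQuotientMap_of_isClosed
    (isQuotientMap_quotient_mk' (s := QuotientGroup.leftRel (componentSubgroup (A := A)))) ?_
  convert (isClosed_connectedComponent (x := (1 : Γ ⧸ A))).preimage hdiv using 1
  ext ⟨f, g⟩
  exact QuotientGroup.eq (s := componentSubgroup (A := A))

theorem isTopologicalGroup_quotient_componentSubgroup [CompactSpace Γ]
    [SeparatelyContinuousMul (Γ ⧸ A)]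
    (hdiv : Continuous fun p : Γ × Γ => ((p.1⁻¹ * p.2 : Γ) : Γ ⧸ A)) :
    IsTopologicalGroup (Γ ⧸ componentSubgroup (A := A)) := by
  have := t2Space_quotient_componentSubgroup hdiv
  set S := componentSubgroup (A := A)
  have hq : IsQuotientMap (QuotientGroup.mk : Γ → Γ ⧸ S) :=
    isQuotientMap_quotient_mk' (s := QuotientGroup.leftRel S)
  have hqA : IsQuotientMap (QuotientGroup.mk : Γ → Γ ⧸ A) :=
    isQuotientMap_quotient_mk' (s := QuotientGroup.leftRel A)
  have hAS : Continuous (QuotientGroup.map A S (MonoidHom.id Γ) le_componentSubgroup) :=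
    hqA.continuous_iff.2 hq.continuous
  have hqq : IsQuotientMap
      (Prod.map (QuotientGroup.mk : Γ → Γ ⧸ S) (QuotientGroup.mk : Γ → Γ ⧸ S)) :=
    IsQuotientMap.of_surjective_continuous (hq.surjective.prodMap hq.surjective)
      (hq.continuous.prodMap hq.continuous)
  have hd : Continuous fun p : (Γ ⧸ S) × (Γ ⧸ S) => p.1⁻¹ * p.2 :=
    hqq.continuous_iff.2 (hAS.comp hdiv)
  have hinv : Continuous fun x : Γ ⧸ S => x⁻¹ := by
    convert hd.comp (Continuous.prodMk continuous_id (continuous_const (y := (1 : Γ ⧸ S)))) using 1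
    ext x
    simp
  refine { continuous_mul := ?_, continuous_inv := hinv }
  convert hd.comp ((hinv.comp continuous_fst).prodMk continuous_snd) using 1
  ext p
  exact congrArg (· * p.2) (inv_inv p.1).symm

theorem totallyDisconnectedSpace_quotient_componentSubgroup [SeparatelyContinuousMul (Γ ⧸ A)]
    [IsTopologicalGroup (Γ ⧸ componentSubgroup (A := A))] :
    TotallyDisconnectedSpace (Γ ⧸ componentSubgroup (A := A)) := by
  set S := componentSubgroup (A := A)
  have hq : IsQuotientMap (QuotientGroup.mk : Γ → Γ ⧸ S) :=
    isQuotientMap_quotient_mk' (s := QuotientGroup.leftRel S)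
  have hqA : IsQuotientMap (QuotientGroup.mk : Γ → Γ ⧸ A) :=
    isQuotientMap_quotient_mk' (s := QuotientGroup.leftRel A)
  set r := QuotientGroup.map A S (MonoidHom.id Γ) le_componentSubgroup
  have hr : IsQuotientMap r := .of_comp_isQuotientMap hqA hq
  have hfib (y : Γ ⧸ S) : IsConnected (r ⁻¹' {y}) := by
    induction y using QuotientGroup.induction_on with | _ g =>
    convert isConnected_connectedComponent (x := (g : Γ ⧸ A)) using 1
    rw [← mul_one (g : Γ ⧸ A), ← smul_connectedComponent]
    ext x
    induction x using QuotientGroup.induction_on with | _ f =>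
    rw [Set.mem_smul_set_iff_inv_smul_mem]
    change ((f : Γ) : Γ ⧸ S) = (g : Γ ⧸ S) ↔ ((g⁻¹ * f : Γ) : Γ ⧸ A) ∈ connectedComponent 1
    rw [eq_comm, QuotientGroup.eq]
    rfl
  rw [totallyDisconnectedSpace_iff_connectedComponent_one, ← map_one r,
    ← hr.isCoinducing.image_connectedComponent hfib]
  ext x
  constructor
  · rintro ⟨y, hy, rfl⟩
    induction y using QuotientGroup.induction_on with | _ f =>
    exact (QuotientGroup.eq_one_iff (N := S) f).2 hy
  · rintro rfl
    exact ⟨1, mem_connectedComponent, rfl⟩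

/-- Let `Γ ⧸ A` be a compact quotient with continuous division and `B` a normal subgroup whose
image in `Γ ⧸ A` is the image of a compact set.  Then the component of the identity of `Γ ⧸ B` is
contained in the image of the component of the identity of `Γ ⧸ A`. -/
theorem exists_mem_componentSubgroup [CompactSpace Γ]
    (hdiv : Continuous fun p : Γ × Γ => ((p.1⁻¹ * p.2 : Γ) : Γ ⧸ A))
    {B : Subgroup Γ} [B.Normal] {K : Set Γ} (hK : IsCompact K) (hKB : K ⊆ B)
    (hBK : ∀ f ∈ B, ∃ k ∈ K, k⁻¹ * f ∈ A)
    {Z : Type*} [TopologicalSpace Z] {ρ : Γ → Z} (hρ : IsQuotientMap ρ)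
    (hρB : ∀ f g, ρ f = ρ g ↔ f⁻¹ * g ∈ B) {x : Γ} (hx : ρ x ∈ connectedComponent (ρ 1)) :
    ∃ s : Γ, (s : Γ ⧸ A) ∈ connectedComponent (1 : Γ ⧸ A) ∧ s⁻¹ * x ∈ B := by
  have := separatelyContinuousMul_of_continuous_div hdiv
  have := t2Space_quotient_componentSubgroup hdiv
  have := isTopologicalGroup_quotient_componentSubgroup hdiv
  have := totallyDisconnectedSpace_quotient_componentSubgroup (A := A)
  set S := componentSubgroup (A := A)
  have hq : IsQuotientMap (QuotientGroup.mk : Γ → Γ ⧸ S) :=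
    isQuotientMap_quotient_mk' (s := QuotientGroup.leftRel S)
  let q : Γ →* Γ ⧸ S := QuotientGroup.mk' S
  have hBimg : ((B.map q : Subgroup (Γ ⧸ S)) : Set (Γ ⧸ S)) = q '' K := by
    ext y
    constructor
    · rintro ⟨f, hf, rfl⟩
      obtain ⟨k, hk, hkf⟩ := hBK f hf
      exact ⟨k, hk, QuotientGroup.eq.2 (le_componentSubgroup hkf)⟩
    · rintro ⟨k, hk, rfl⟩
      exact ⟨k, hKB hk, rfl⟩
  have hBcl : IsClosed ((B.map q : Subgroup (Γ ⧸ S)) : Set (Γ ⧸ S)) := by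
    rw [hBimg]
    exact (hK.image hq.continuous).isClosed
  have hxB : q x ∈ B.map q := by
    by_contra hxB
    obtain ⟨U, hU⟩ := ProfiniteGrp.exist_openNormalSubgroup_sub_open_nhds_of_one
      (U := {u | q x * u ∉ B.map q}) (hBcl.isOpen_compl.preimage (continuous_const_mul (q x)))
      (by simpa using hxB)
    have hUo : IsOpen (((U : Subgroup (Γ ⧸ S)) : Set (Γ ⧸ S))) := U.isOpen'
    have hWo := Subgroup.isOpen_mono (le_sup_right : (U : Subgroup (Γ ⧸ S)) ≤ B.map q ⊔ U) hUo
    have hWc := Subgroup.isClosed_of_isOpen _ hWo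
    set W := B.map q ⊔ (U : Subgroup (Γ ⧸ S))
    have hBW : B ≤ W.comap q := Subgroup.map_le_iff_le_comap.1 le_sup_left
    have hpre : ρ ⁻¹' (ρ '' (W.comap q)) = q ⁻¹' W := by
      ext f
      constructor
      · rintro ⟨g, hg, hgf⟩
        have := mul_mem hg (hBW ((hρB g f).1 hgf))
        rwa [mul_inv_cancel_left] at this
      · intro hf
        exact ⟨f, hf, rfl⟩
    have hcl : IsClopen (ρ '' (W.comap q)) := by
      constructor
      · rw [← hρ.isClosed_preimage, hpre]
        exact hWc.preimage hq.continuous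
      · rw [← hρ.isOpen_preimage, hpre]
        exact hWo.preimage hq.continuous
    have hxW : x ∈ ρ ⁻¹' (ρ '' (W.comap q)) :=
      hcl.connectedComponent_subset ⟨1, one_mem _, rfl⟩ hx
    rw [hpre] at hxW
    obtain ⟨y, hy, u, hu, hyu⟩ := Subgroup.mem_sup_of_normal_right.1 (show q x ∈ W from hxW)
    refine hU (inv_mem hu) ?_
    rw [← hyu, mul_inv_cancel_right]
    exact hy
  obtain ⟨f, hf, hfx⟩ := hxB
  refine ⟨x * f⁻¹, ?_, ?_⟩
  · have h : (x * f⁻¹) ∈ S := by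
      rw [← QuotientGroup.eq_one_iff (N := S)]
      change q (x * f⁻¹) = 1
      rw [map_mul, map_inv, hfx, mul_inv_cancel]
    exact h
  · simpa using hf

end Division

end Topological
section Model

open Topology

variable {γ : Type u} (pE : Set (L.Formula (γ ⊕ γ))) (a : γ → M)

theorem realize_aut_comp (f : M ≃[L] M) {ι : Type*} (φ : L.Formula ι) (v : ι → M) :
    φ.Realize (fun i => f (v i)) ↔ φ.Realize v :=
  FirstOrder.Language.StrongHomClass.realize_formula f φ

theorem realize_congr {ι : Type*} {φ : L.Formula ι} {v w : ι → M} (h : ∀ i, v i = w i) :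
    φ.Realize v ↔ φ.Realize w :=
  iff_of_eq (congrArg _ (funext h))

theorem Frel_smul_iff (f : M ≃[L] M) (x y : γ → M) :
    Frel pE (f • x) (f • y) ↔ Frel pE x y := by
  refine forall₂_congr fun φ _ => ?_
  rw [← realize_aut_comp f φ (Sum.elim x y)]
  exact iff_of_eq (congrArg _ (by ext (i | i) <;> rfl))

variable {pE} in
theorem mem_AutE_iff (hE : Equivalence (Frel (M := M) pE)) {f : M ≃[L] M} :
    f ∈ AutE pE a ↔ Frel pE a (f • a) := by
  constructor
  · intro hf
    have h : f • Fclass pE a = Fclass pE a := hf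
    change f • a ∈ Fclass pE a
    rw [← h]
    exact Set.smul_mem_smul_set (hE.refl a)
  · intro hf
    change f • Fclass pE a = Fclass pE a
    ext x
    rw [Set.mem_smul_set_iff_inv_smul_mem]
    change Frel pE a (f⁻¹ • x) ↔ Frel pE a x
    rw [← Frel_smul_iff pE f, smul_inv_smul]
    exact ⟨fun h => hE.trans hf h, fun h => hE.trans (hE.symm hf) h⟩

/-- The topology on `Aut_e(𝔠)` induced by `f ↦ tp(f(s)/s)`. -/
noncomputable def topTuple {ι : Type u} (s : ι → M) : TopologicalSpace (Ge pE a) :=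
  TopologicalSpace.induced (fun f φ => (tpOver (L := L) s (f • s)).boolIndicator φ) inferInstance

theorem ultrafilter_le_nhds_topTuple {ι : Type u} (s : ι → M) (U : Ultrafilter (Ge pE a))
    (f : Ge pE a) : ↑U ≤ @nhds _ (topTuple pE a s) f ↔
      ∀ φ : L.Formula (ι ⊕ ι), φ.Realize (Sum.elim (f • s) s) ↔
        ∀ᶠ g in (U : Filter (Ge pE a)), φ.Realize (Sum.elim (g • s) s) := by
  rw [topTuple, nhds_induced, ← Filter.tendsto_iff_comap, tendsto_pi_nhds]
  refine forall_congr' fun φ => ?_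
  rw [nhds_discrete, Filter.tendsto_pure]
  change (∀ᶠ g in (U : Filter (Ge pE a)), (tpOver (L := L) s (g • s)).boolIndicator φ =
    (tpOver (L := L) s (f • s)).boolIndicator φ) ↔ (φ ∈ tpOver (L := L) s (f • s) ↔
      ∀ᶠ g in (U : Filter (Ge pE a)), φ ∈ tpOver (L := L) s (g • s))
  by_cases h : φ ∈ tpOver (L := L) s (f • s)
  · simp only [(Set.mem_iff_boolIndicator _ _).1 h, h, true_iff, Set.mem_iff_boolIndicator]
  · simp only [(Set.notMem_iff_boolIndicator _ _).1 h, h, false_iff, ← Set.notMem_iff_boolIndicator]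
    exact Ultrafilter.eventually_not

variable {κ pE a}

/-- By saturation, the limit of the types of a family of small tuples is realized. -/
theorem exists_limit_tuple (hM : IsMonster κ L M) {I : Type*} (U : Ultrafilter I) {δ π : Type u}
    (hδ : #δ < κ) (hπ : #π < κ) (v : I → δ → M) (prm : π → M) :
    ∃ w : δ → M, ∀ φ : L.Formula (δ ⊕ π),
      φ.Realize (Sum.elim w prm) ↔ ∀ᶠ i in (U : Filter I), φ.Realize (Sum.elim (v i) prm) := by
  obtain ⟨w, hw⟩ := hM.2.2 δ π prm {φ | ∀ᶠ i in (U : Filter I), φ.Realize (Sum.elim (v i) prm)} hδ hπ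
    (fun q hq => by
      have h : ∀ᶠ i in (U : Filter I), ∀ φ ∈ q, φ.Realize (Sum.elim (v i) prm) :=
        (Filter.eventually_all_finset q).2 fun φ hφ => hq hφ
      obtain ⟨i, hi⟩ := h.exists
      exact ⟨v i, hi⟩)
  refine ⟨w, fun φ => ⟨fun h => ?_, fun h => hw φ h⟩⟩
  by_contra hn
  exact hw φ.not (Ultrafilter.eventually_not.2 hn) h

theorem mk_sum_lt (hM : IsMonster κ L M) {α β : Type u} (hα : #α < κ) (hβ : #β < κ) :
    #(α ⊕ β) < κ := by
  rw [← Cardinal.add_def]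
  exact Cardinal.add_lt_of_lt hM.1.le hα hβ

theorem mk_prod_lt (hM : IsMonster κ L M) {α β : Type u} (hα : #α < κ) (hβ : #β < κ) :
    #(α × β) < κ := by
  rw [← Cardinal.mul_def]
  exact Cardinal.mul_lt_of_lt hM.1.le hα hβ

/-- Limits of types of small families of automorphisms in `Aut_e(𝔠)` are realized by
automorphisms in `Aut_e(𝔠)`. -/
theorem exists_limit_aut (hM : IsMonster κ L M) (hγ : #γ < κ)
    (hE : Equivalence (Frel (M := M) pE)) {I : Type*} (U : Ultrafilter I) {K ι π : Type u}
    (hK : #K < κ) (hι : #ι < κ) (hπ : #π < κ) (F : K → I → Ge pE a) (t : ι → M) (prm : π → M) :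
    ∃ f : K → Ge pE a, ∀ {ρ : Type u} (m : ρ → (K × ι) ⊕ π) (φ : L.Formula ρ),
      φ.Realize (Sum.elim (fun p : K × ι => (f p.1 • t) p.2) prm ∘ m) ↔
        ∀ᶠ i in (U : Filter I), φ.Realize (Sum.elim (fun p : K × ι => (F p.1 i • t) p.2) prm ∘ m) := by
  obtain ⟨w, hw⟩ := exists_limit_tuple hM U (mk_prod_lt hM hK (mk_sum_lt hM hι hγ))
    (mk_sum_lt hM hπ hγ) (fun i (p : K × (ι ⊕ γ)) => (F p.1 i • Sum.elim t a) p.2)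
    (Sum.elim prm a)
  have hw' {ρ : Type u} (m : ρ → (K × (ι ⊕ γ)) ⊕ (π ⊕ γ)) (φ : L.Formula ρ) :
      φ.Realize (Sum.elim w (Sum.elim prm a) ∘ m) ↔ ∀ᶠ i in (U : Filter I), φ.Realize
        (Sum.elim (fun p : K × (ι ⊕ γ) => (F p.1 i • Sum.elim t a) p.2) (Sum.elim prm a) ∘ m) := by
    simpa only [FirstOrder.Language.Formula.realize_relabel] using hw (φ.relabel m)
  have key (k : K) : ∃ f : Ge pE a, ∀ j, (f • t) j = w (k, Sum.inl j) := by
    obtain ⟨f, hf⟩ := hM.2.1 (ι ⊕ γ) (Sum.elim t a) (fun j => w (k, j)) (mk_sum_lt hM hι hγ)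
      (fun φ => by
        have h := hw' (fun j => Sum.inl (k, j)) φ
        refine Iff.trans ?_ h.symm
        have h' (i : I) := realize_aut_comp (F k i : M ≃[L] M) φ (Sum.elim t a)
        change _ ↔ ∀ᶠ i in (U : Filter I), φ.Realize (fun j => (F k i : M ≃[L] M) (Sum.elim t a j))
        simp only [h', Filter.eventually_const])
    have hfE : f ∈ AutE pE a := by
      rw [mem_AutE_iff a hE]
      intro φ hφ
      have h := (hw' (Sum.elim (fun j => Sum.inr (Sum.inr j))
        (fun j => Sum.inl (k, Sum.inr j))) φ).2 (.of_forall fun i => by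
          convert (mem_AutE_iff a hE).1 (F k i).2 φ hφ using 1
          ext (j | j) <;> rfl)
      convert h using 1
      ext (j | j)
      · rfl
      · exact hf (Sum.inr j)
    exact ⟨⟨f, hfE⟩, fun j => hf (Sum.inl j)⟩
  choose f hf using key
  refine ⟨f, fun {ρ} m φ => ?_⟩
  refine (realize_congr fun j => ?_).trans
    ((hw' (Sum.map (Prod.map id Sum.inl) Sum.inl ∘ m) φ).trans
      (Filter.eventually_congr (.of_forall fun i => realize_congr fun j => ?_)))
  · rcases h : m j with p | p <;> simp [h, hf, Prod.map]
  · simp only [Function.comp_apply]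
    rcases m j with p | p <;> rfl

theorem exists_limit_aut_single (hM : IsMonster κ L M) (hγ : #γ < κ)
    (hE : Equivalence (Frel (M := M) pE)) (U : Ultrafilter (Ge pE a)) {ι π : Type u}
    (hι : #ι < κ) (hπ : #π < κ) (t : ι → M) (prm : π → M) :
    ∃ f : Ge pE a, ∀ {ρ : Type u} (m : ρ → ι ⊕ π) (φ : L.Formula ρ),
      φ.Realize (Sum.elim (f • t) prm ∘ m) ↔
        ∀ᶠ g in (U : Filter (Ge pE a)), φ.Realize (Sum.elim (g • t) prm ∘ m) := by
  obtain ⟨f, hf⟩ := exists_limit_aut hM hγ hE U (K := PUnit)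
    (by simpa using Cardinal.one_lt_aleph0.trans hM.1) hι hπ (fun _ g => g) t prm
  refine ⟨f PUnit.unit, fun {ρ} m φ => ?_⟩
  refine (realize_congr fun j => ?_).trans ((hf (Sum.map (Prod.mk PUnit.unit) id ∘ m) φ).trans
    (Filter.eventually_congr (.of_forall fun g => realize_congr fun j => ?_))) <;>
  · simp only [Function.comp_apply]
    rcases m j with p | p <;> rfl

/-- The pointwise stabilizer of a small tuple is compact. -/
theorem isCompact_fixer (hM : IsMonster κ L M) (hγ : #γ < κ)
    (hE : Equivalence (Frel (M := M) pE)) {ι ι' : Type u} (hι : #ι < κ) (hι' : #ι' < κ)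
    (s : ι → M) (t : ι' → M) :
    @IsCompact _ (topTuple pE a s) {f : Ge pE a | f • t = t} := by
  let _ := topTuple pE a s
  rw [isCompact_iff_ultrafilter_le_nhds']
  intro U hU
  obtain ⟨f, hf⟩ := exists_limit_aut_single hM hγ hE U (mk_sum_lt hM hι hι')
    (mk_sum_lt hM hι hι') (Sum.elim s t) (Sum.elim s t)
  refine ⟨f, funext fun j => ?_, ?_⟩
  · have h := (hf (Sum.elim (fun _ : PUnit.{u + 1} => Sum.inl (Sum.inr j))
      fun _ : PUnit.{u + 1} => Sum.inr (Sum.inr j))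
      (FirstOrder.Language.Term.equal (.var (Sum.inl PUnit.unit)) (.var (Sum.inr PUnit.unit)))).2 (by
        filter_upwards [hU] with g hg
        simpa using congrFun hg j)
    simpa using h
  · rw [ultrafilter_le_nhds_topTuple]
    intro φ
    exact (realize_congr (by rintro (p | p) <;> rfl)).trans ((hf (Sum.map Sum.inl Sum.inl) φ).trans
      (Filter.eventually_congr (.of_forall fun _ => realize_congr (by rintro (p | p) <;> rfl))))

theorem exists_fixer_mul_of_sameTp (hM : IsMonster κ L M) {ι : Type u} (hι : #ι < κ) {s : ι → M}
    (hs : eInDclTuple pE a s) {f g : Ge pE a}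
    (h : ∀ φ : L.Formula (ι ⊕ ι),
      φ.Realize (Sum.elim (f • s) s) ↔ φ.Realize (Sum.elim (g • s) s)) :
    ∃ h k : Ge pE a, h • s = s ∧ k • s = s ∧ g = h * f * k := by
  obtain ⟨u, hu⟩ := hM.2.1 _ (Sum.elim (f • s) s) (Sum.elim (g • s) s) (mk_sum_lt hM hι hι) h
  have hus (i : ι) : u (s i) = s i := hu (Sum.inr i)
  refine ⟨⟨u, hs u hus⟩, f⁻¹ * ⟨u, hs u hus⟩⁻¹ * g, funext hus, ?_, by group⟩
  have hfg : (⟨u, hs u hus⟩ : Ge pE a) • f • s = g • s := funext fun i => hu (Sum.inl i)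
  rw [mul_smul, mul_smul, ← hfg, inv_smul_smul, inv_smul_smul]

/-- Closedness of a set of automorphisms does not depend on the tuple used to define the
topology, as long as the set is invariant under the pointwise stabilizers. -/
theorem isClosed_topTuple_change (hM : IsMonster κ L M) (hγ : #γ < κ)
    (hE : Equivalence (Frel (M := M) pE)) {ι ι' : Type u} (hι : #ι < κ) (hι' : #ι' < κ)
    {s : ι → M} {t : ι' → M} (ht : eInDclTuple pE a t)
    {D : Set (Ge pE a)} (hD : @IsClosed _ (topTuple pE a s) D)
    (hDt : ∀ h k f : Ge pE a, h • t = t → k • t = t → f ∈ D → h * f * k ∈ D) :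
    @IsClosed _ (topTuple pE a t) D := by
  refine (@isClosed_iff_ultrafilter _ D (topTuple pE a t)).2 ?_
  intro g U hUg hUD
  rw [ultrafilter_le_nhds_topTuple] at hUg
  obtain ⟨f, hf⟩ := exists_limit_aut_single hM hγ hE U (mk_sum_lt hM hι hι')
    (mk_sum_lt hM hι hι') (Sum.elim s t) (Sum.elim s t)
  have hfD : f ∈ D := by
    refine (@isClosed_iff_ultrafilter _ D (topTuple pE a s)).1 hD f U ?_ hUD
    rw [ultrafilter_le_nhds_topTuple]
    intro φ
    exact (realize_congr (by rintro (p | p) <;> rfl)).trans ((hf (Sum.map Sum.inl Sum.inl) φ).trans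
      (Filter.eventually_congr (.of_forall fun _ => realize_congr (by rintro (p | p) <;> rfl))))
  obtain ⟨h, k, hh, hk, rfl⟩ := exists_fixer_mul_of_sameTp hM hι' ht (f := f) (g := g) (fun φ => by
    rw [hUg]
    exact (realize_congr (by rintro (p | p) <;> rfl)).trans ((hf (Sum.map Sum.inr Sum.inr) φ).trans
      (Filter.eventually_congr (.of_forall fun _ => realize_congr (by rintro (p | p) <;> rfl)))))
  exact hDt h k f hh hk hfD

/-- The division map `(f, g) ↦ [f⁻¹ g]` is continuous modulo a normal subgroup containing the
pointwise stabilizer of the tuple `s`. -/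
theorem continuous_div_topTuple (hM : IsMonster κ L M) (hγ : #γ < κ)
    (hE : Equivalence (Frel (M := M) pE)) {ι : Type u} (hι : #ι < κ)
    {s : ι → M} (hs : eInDclTuple pE a s) {A : Subgroup (Ge pE a)} [A.Normal]
    (hA : ∀ h : Ge pE a, h • s = s → h ∈ A) :
    let _ := topTuple pE a s
    Continuous fun p : Ge pE a × Ge pE a => ((p.1⁻¹ * p.2 : Ge pE a) : Ge pE a ⧸ A) := by
  intro τ
  rw [continuous_iff_isClosed]
  intro C hC
  have hD : IsClosed ((QuotientGroup.mk : Ge pE a → Ge pE a ⧸ A) ⁻¹' C) :=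
    hC.preimage continuous_quotient_mk'
  have hDmk {f g : Ge pE a} (h : (f : Ge pE a ⧸ A) = g) :
      f ∈ (QuotientGroup.mk : Ge pE a → Ge pE a ⧸ A) ⁻¹' C ↔
        g ∈ (QuotientGroup.mk : Ge pE a → Ge pE a ⧸ A) ⁻¹' C := by
    simp only [Set.mem_preimage, h]
  rw [isClosed_iff_ultrafilter]
  rintro ⟨f₀, g₀⟩ U hU hUC
  rw [nhds_prod_eq] at hU
  have hU₁ := (ultrafilter_le_nhds_topTuple pE a s (U.map Prod.fst) f₀).1
    (Filter.tendsto_fst.mono_left hU)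
  have hU₂ := (ultrafilter_le_nhds_topTuple pE a s (U.map Prod.snd) g₀).1
    (Filter.tendsto_snd.mono_left hU)
  obtain ⟨F, hF⟩ := exists_limit_aut hM hγ hE U (K := ULift.{u} Bool)
    (by simpa using (Cardinal.natCast_lt_aleph0 (n := 2)).trans hM.1) hι hι
    (fun k p => if k.down then p.1 else p.2) s s
  obtain ⟨h₁, k₁, hh₁, hk₁, rfl⟩ := exists_fixer_mul_of_sameTp hM hι hs (f := F ⟨true⟩) (g := f₀)
    (fun φ => by
      rw [hU₁]
      exact (realize_congr (by rintro (p | p) <;> rfl)).trans ((hF (Sum.map (Prod.mk ⟨true⟩) id) φ).trans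
        (Filter.eventually_congr (.of_forall fun _ => realize_congr (by rintro (p | p) <;> rfl)))))
  obtain ⟨h₂, k₂, hh₂, hk₂, rfl⟩ := exists_fixer_mul_of_sameTp hM hι hs (f := F ⟨false⟩) (g := g₀)
    (fun φ => by
      rw [hU₂]
      exact (realize_congr (by rintro (p | p) <;> rfl)).trans ((hF (Sum.map (Prod.mk ⟨false⟩) id) φ).trans
        (Filter.eventually_congr (.of_forall fun _ => realize_congr (by rintro (p | p) <;> rfl)))))
  have hlim : (F ⟨true⟩)⁻¹ * F ⟨false⟩ ∈ (QuotientGroup.mk : Ge pE a → Ge pE a ⧸ A) ⁻¹' C := by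
    refine isClosed_iff_ultrafilter.1 hD _ (U.map fun p : Ge pE a × Ge pE a => p.1⁻¹ * p.2) ?_ hUC
    refine (ultrafilter_le_nhds_topTuple pE a s _ _).2 fun φ => ?_
    have hmul (f g : Ge pE a) : φ.Realize (Sum.elim ((f⁻¹ * g) • s) s) ↔
        φ.Realize (Sum.elim (g • s) (f • s)) := by
      rw [← realize_aut_comp (f : M ≃[L] M)]
      refine iff_of_eq (congrArg _ ?_)
      ext (p | p)
      · exact congrFun (show f • (f⁻¹ * g) • s = g • s by rw [← mul_smul, mul_inv_cancel_left]) p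
      · rfl
    rw [Ultrafilter.coe_map, Filter.eventually_map]
    simp only [hmul]
    exact (realize_congr (by rintro (p | p) <;> rfl)).trans ((hF (Sum.elim (fun j => Sum.inl (⟨false⟩, j)) fun j => Sum.inl (⟨true⟩, j)) φ).trans
      (Filter.eventually_congr (.of_forall fun _ => realize_congr (by rintro (p | p) <;> rfl))))
  refine (hDmk ?_).1 hlim
  simp only [QuotientGroup.mk_mul, QuotientGroup.mk_inv, (QuotientGroup.eq_one_iff _).2 (hA _ hh₁),
    (QuotientGroup.eq_one_iff _).2 (hA _ hk₁), (QuotientGroup.eq_one_iff _).2 (hA _ hh₂),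
    (QuotientGroup.eq_one_iff _).2 (hA _ hk₂), one_mul, mul_one]

end Model
section Bridge

open Topology

variable {γ : Type u} {pE : Set (L.Formula (γ ⊕ γ))} {a : γ → M}

/-- A quotient topology defined through a space of types agrees with the one defined through
automorphisms. -/
theorem coinduced_typeSetTop_eq {Z : Type*} {ι : Type u} (s : ι → M) {R : Ge pE a → Z}
    (hR : ∀ f g : Ge pE a, tpOver (L := L) s (f • s) = tpOver s (g • s) → R f = R g) :
    (typeSetTop (Set.range fun g : Ge pE a => tpOver (L := L) s (g • s))).coinduced
      (fun p => R (Set.mem_range.mp p.2).choose) = (topTuple pE a s).coinduced R := by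
  let X := Set.range fun g : Ge pE a => tpOver (L := L) s (g • s)
  let q : Ge pE a → X := Set.rangeFactorization _
  let _ : TopologicalSpace (Ge pE a) := topTuple pE a s
  let _ : TopologicalSpace X := typeSetTop X
  have hq : IsInducing q := ⟨(induced_compose (f := q)
    (g := fun (p : X) φ => (p : Set (L.Formula (ι ⊕ ι))).boolIndicator φ)).symm⟩
  have hq' : IsQuotientMap q := hq.isQuotientMap_of_surjective Set.rangeFactorization_surjective
  have hRq : R = (fun p : X => R (Set.mem_range.mp p.2).choose) ∘ q :=
    funext fun f => hR _ _ (Set.mem_range.mp (q f).2).choose_spec.symm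
  conv_rhs => rw [hRq, ← coinduced_compose]
  exact congrArg _ hq'.eq_coinduced

theorem projS_surjective {V β : Type u}
    {pS : Set (L.Formula (V ⊕ β))} {bp : β → M} (hInv : SolInv pE a pS bp) :
    Function.Surjective (projS κ pE a hInv) :=
  (QuotientGroup.mk_surjective).comp (resPerm pE a hInv).rangeRestrict_surjective

variable {κ}

theorem eq_of_tpOver_eq (hM : IsMonster κ L M) {Z : Type*} {ι : Type u} (hι : #ι < κ) {s : ι → M}
    (hs : eInDclTuple pE a s) {R : Ge pE a → Z} {B : Subgroup (Ge pE a)} [B.Normal]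
    (hR : ∀ f g : Ge pE a, R f = R g ↔ f⁻¹ * g ∈ B) (hsB : ∀ h : Ge pE a, h • s = s → h ∈ B)
    {f g : Ge pE a} (h : tpOver (L := L) s (f • s) = tpOver s (g • s)) : R f = R g := by
  obtain ⟨u, k, hu, hk, rfl⟩ := exists_fixer_mul_of_sameTp hM hι hs (fun φ => Set.ext_iff.1 h φ)
  rw [hR, mul_assoc, ← mul_assoc u f k, ← mul_assoc, ← mul_assoc]
  refine mul_mem ?_ (hsB k hk)
  simpa using ‹B.Normal›.conj_mem u (hsB u hu) f⁻¹

/-- The quotient topology modulo a normal subgroup does not depend on the tuple used, as long as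
its pointwise stabilizer is contained in the subgroup. -/
theorem coinduced_topTuple_eq (hM : IsMonster κ L M) (hγ : #γ < κ)
    (hE : Equivalence (Frel (M := M) pE)) {Z : Type*} {ι ι' : Type u} (hι : #ι < κ)
    (hι' : #ι' < κ) {s : ι → M} {t : ι' → M} (hs : eInDclTuple pE a s) (ht : eInDclTuple pE a t)
    {R : Ge pE a → Z} {B : Subgroup (Ge pE a)} [B.Normal]
    (hR : ∀ f g : Ge pE a, R f = R g ↔ f⁻¹ * g ∈ B) (hsB : ∀ h : Ge pE a, h • s = s → h ∈ B)
    (htB : ∀ h : Ge pE a, h • t = t → h ∈ B) :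
    (topTuple pE a s).coinduced R = (topTuple pE a t).coinduced R := by
  have hinv (C : Set Z) (h k f : Ge pE a) (hh : h ∈ B) (hk : k ∈ B) (hf : f ∈ R ⁻¹' C) :
      h * f * k ∈ R ⁻¹' C := by
    have : R f = R (h * f * k) := by
      rw [hR, mul_assoc, ← mul_assoc h f k, ← mul_assoc, ← mul_assoc]
      refine mul_mem ?_ hk
      simpa using ‹B.Normal›.conj_mem h hh f⁻¹
    rwa [Set.mem_preimage, ← this]
  refine TopologicalSpace.ext_iff_isClosed.2 fun C => ?_
  rw [isClosed_coinduced, isClosed_coinduced]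
  exact ⟨fun h => isClosed_topTuple_change hM hγ hE hι hι' ht h
      fun u k f hu hk hf => hinv C u k f (htB u hu) (htB k hk) hf,
    fun h => isClosed_topTuple_change hM hγ hE hι' hι hs h
      fun u k f hu hk hf => hinv C u k f (hsB u hu) (hsB k hk) hf⟩

theorem galTopT_eq (hM : IsMonster κ L M) {N : L.ElementarySubstructure M} (hN : #N < κ)
    (hs : eInDclTuple pE a (Subtype.val : ↥N → M))
    (hsA : ∀ h : Ge pE a, h • (Subtype.val : ↥N → M) = Subtype.val → h ∈ AutfL κ pE a) :
    galTopT κ pE a N =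
      (topTuple pE a (Subtype.val : ↥N → M)).coinduced (projT κ pE a) :=
  coinduced_typeSetTop_eq _ fun _ _ h =>
    eq_of_tpOver_eq hM hN hs (fun _ _ => QuotientGroup.eq) hsA h

theorem galTopb_eq (hM : IsMonster κ L M) {V β : Type u} {pS : Set (L.Formula (V ⊕ β))}
    {bp : β → M} {hInv : SolInv pE a pS bp} {ιb : Type u} {b : ιb → SolT pS bp}
    (hιb : #(ιb × V) < κ) (hb : eInDclTuple pE a (flat b)) {B : Subgroup (Ge pE a)} [B.Normal]
    (hB : ∀ f g : Ge pE a, projS κ pE a hInv f = projS κ pE a hInv g ↔ f⁻¹ * g ∈ B)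
    (hbB : ∀ h : Ge pE a, h • flat b = flat b → h ∈ B) :
    galTopb κ pE a hInv b = (topTuple pE a (flat b)).coinduced (projS κ pE a hInv) :=
  coinduced_typeSetTop_eq _ fun _ _ h => eq_of_tpOver_eq hM hιb hb hB hbB h

end Bridge

section Statements

variable {γ : Type u} (pE : Set (L.Formula (γ ⊕ γ))) (a : γ → M)
variable {V β : Type u} {pS : Set (L.Formula (V ⊕ β))} {bp : β → M}


/-- Theorem 2.18(2): assuming `e ∈ dcl(Σ)`, the connected
component of the identity of `Gal_L(Σ, e)` equals
`Autf_S(Σ, e)/Autf_L(Σ, e)`. -/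
theorem component_one_eq_autfSS (hM : IsMonster κ L M) (hγ : #γ < κ)
    (hE : Equivalence (Frel (M := M) pE)) (hV : #V < κ) (hβ : #β < κ)
    (hInv : SolInv pE a pS bp)
    (hedcl : eInDclSigma κ pE a pS bp)
    {ιb : Type u} (b : ιb → SolT pS bp)
    (hb : IsLascarTuple κ pE a hInv b) (hbdcl : eInDclTuple pE a (flat b))
    (N : L.ElementarySubstructure M) (hN : #N < κ)
    (hNdcl : ∀ g : M ≃[L] M, (∀ x ∈ N, g x = x) → g ∈ AutE pE a) :
    @connectedComponent _ (galTopb κ pE a hInv b) (projb κ pE a hInv 1) =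
      projb κ pE a hInv '' AutfSSset κ pE a hInv N := by
  have := AutfLS_normal κ pE a hInv
  let s : ↥N → M := Subtype.val
  have hs : eInDclTuple pE a s := fun f hf => hNdcl f fun x hx => hf ⟨x, hx⟩
  have hιb : #(ιb × V) < κ := mk_prod_lt hM hb.1 hV
  have hsA (h : Ge pE a) (hh : h • s = s) : h ∈ AutfL κ pE a :=
    Subgroup.subset_normalClosure ⟨N, hN, hNdcl, fun x hx => congrFun hh ⟨x, hx⟩⟩
  let B : Subgroup (Ge pE a) := (AutfLS κ pE a hInv).comap (toGS pE a hInv)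
  have hAB : AutfL κ pE a ≤ B := fun f hf => toGS_mem_autfLS κ pE a hInv hf
  have hbB (h : Ge pE a) (hh : h • flat b = flat b) : h ∈ B :=
    (hb.2 _).2 (by rw [flat_toGS_smul, hh]; exact LEq.refl κ pE a _)
  have hprojS (f g : Ge pE a) : projS κ pE a hInv f = projS κ pE a hInv g ↔ f⁻¹ * g ∈ B := by
    rw [Subgroup.mem_comap, map_mul, map_inv]
    exact QuotientGroup.eq
  have hgalb := galTopb_eq hM hιb hbdcl hprojS hbB
  have hgalT := galTopT_eq (κ := κ) hM hN hs hsA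
  have htop : galTopb κ pE a hInv b = (topTuple pE a s).coinduced (projS κ pE a hInv) := by
    rw [hgalb]
    exact coinduced_topTuple_eq hM hγ hE hιb hN hbdcl hs hprojS hbB fun h hh => hAB (hsA h hh)
  let _ : TopologicalSpace (Ge pE a) := topTuple pE a s
  let _ : TopologicalSpace (GalL κ pE a hInv) := galTopb κ pE a hInv b
  let _ : TopologicalSpace (GalT κ pE a) := galTopT κ pE a N
  have hρ : Topology.IsQuotientMap (projS κ pE a hInv) :=
    ⟨⟨htop⟩, projS_surjective κ hInv⟩
  change connectedComponent (projS κ pE a hInv 1) = _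
  have hcomp (f : Ge pE a) : f ∈ AutfSset κ pE a N ↔
      (f : Ge pE a ⧸ AutfL κ pE a) ∈ connectedComponent (1 : Ge pE a ⧸ AutfL κ pE a) := by
    change projT κ pE a f ∈ @connectedComponent _ (galTopT κ pE a N) (projT κ pE a 1) ↔ _
    rw [hgalT]
    rfl
  apply Set.Subset.antisymm
  · intro y hy
    obtain ⟨x, rfl⟩ := projS_surjective κ hInv y
    have : CompactSpace (Ge pE a) := ⟨by
      convert isCompact_fixer hM hγ hE hN (Cardinal.mk_lt_aleph0.trans hM.1) s
        (PEmpty.elim : PEmpty.{u + 1} → M)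
      exact (Set.eq_univ_of_forall fun f => Subsingleton.elim _ _).symm⟩
    obtain ⟨g, hg, hgx⟩ := exists_mem_componentSubgroup (A := AutfL κ pE a)
      (continuous_div_topTuple hM hγ hE hN hs hsA) (isCompact_fixer hM hγ hE hN hιb s (flat b))
      hbB (fun f hf => by
        obtain ⟨h, hh, hhb⟩ := (hb.2 _).1 hf
        rw [flat_toGS_smul] at hhb
        refine ⟨h⁻¹ * f, ?_, ?_⟩
        · change (h⁻¹ * f) • flat b = flat b
          rw [mul_smul, ← hhb, inv_smul_smul]
        · simpa [mul_assoc] using (AutfL_normal κ pE a).conj_mem h hh f⁻¹)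
      hρ hprojS hy
    refine ⟨toGS pE a hInv x, fun ι hι c => ?_, rfl⟩
    have hxg : x * g⁻¹ ∈ B := by
      simpa [mul_assoc] using (inferInstance : B.Normal).conj_mem _ hgx g
    obtain ⟨h, hh, hhc⟩ := hxg ι hι (toGS pE a hInv g • c)
    refine ⟨h * g, ?_, ?_⟩
    · rw [hcomp]
      rwa [QuotientGroup.mk_mul, (QuotientGroup.eq_one_iff h).2 hh, one_mul]
    · rw [flat_toGS_smul, flat_toGS_smul, flat_toGS_smul, ← mul_smul, ← mul_smul,
        inv_mul_cancel_right] at hhc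
      rw [hhc, flat_toGS_smul]
  · rintro _ ⟨σ, hσ, rfl⟩
    obtain ⟨x, rfl⟩ := (resPerm pE a hInv).rangeRestrict_surjective σ
    obtain ⟨f, hf, hfb⟩ := hσ ιb hb.1 b
    have hfx : projS κ pE a hInv f = projS κ pE a hInv x := by
      refine (hprojS f x).2 (hbB _ ?_)
      rw [mul_smul, inv_smul_eq_iff]
      exact hfb.symm
    change projS κ pE a hInv x ∈ _
    rw [← hfx]
    have hπ : Topology.IsQuotientMap (projT κ pE a) := ⟨⟨hgalT⟩, QuotientGroup.mk_surjective⟩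
    have hxi : Continuous (xiL κ pE a hInv) := hπ.continuous_iff.2 hρ.continuous
    exact hxi.mapsTo_connectedComponent (projT κ pE a 1) hf

end Statements

end RelLascar
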